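/- arXiv:2305.01143 — 3 statements merged into one kernel-verified Lean document; each statement's English description precedes it below -/
import Mathlib

section
/- Let Σ be a d×d symmetric positive definite matrix and let p be the density of the Gaussian distribution N(0, Σ) on ℝ^d. Let κ be the Gaussian kernel κ(x,x') = exp(−‖x − x'‖² / (2 σ_κ²)) with width σ_κ > 0, so that κ²(x,x') = exp(−‖x − x'‖²/σ_κ²) and C_κ = (π σ_κ²)^{−d/2}. Then the kernelized Rényi entropy of p equals S₁(p) = (d/2) log(2πe) + (1/2) log det Σ + (σ_κ²/4) tr(Σ⁻¹). -/
open MeasureTheory Real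

noncomputable section

/-- Euclidean space `ℝ^d` with Lebesgue measure. -/
abbrev Euc (d : ℕ) := EuclideanSpace ℝ (Fin d)

/-- Normalizing constant `C_κ = 1 / ∫ κ²(0,x) dx` of a kernel. -/
def Cker {α : Type*} [MeasureSpace α] [Zero α] (κ : α → α → ℝ) : ℝ :=
  1 / ∫ x, (κ 0 x) ^ 2

/-- A kernel is admissible if it is normalized, shift invariant and L²-integrable. -/
def Admissible {α : Type*} [NormedAddCommGroup α] [MeasureSpace α] (κ : α → α → ℝ) : Prop :=
  (∀ x, κ x x = 1) ∧ (∃ f : ℝ → ℝ, ∀ x x', κ x x' = f ‖x - x'‖) ∧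
  ∀ x, MeasureTheory.Integrable (fun x' => (κ x x') ^ 2)

/-- Kernelized Rényi entropy `S₁(p) = −C_κ ∬ p(x) log p(x') κ²(x,x') dx dx'`. -/
def S1 {α : Type*} [MeasureSpace α] [Zero α] (κ : α → α → ℝ) (p : α → ℝ) : ℝ :=
  -(Cker κ * ∫ x, ∫ x', p x * Real.log (p x') * (κ x x') ^ 2)

/-- Shannon differential entropy `H(p) = −∫ p log p`. -/
def ShannonH {α : Type*} [MeasureSpace α] (p : α → ℝ) : ℝ := -∫ x, p x * Real.log (p x)

/-- Discrepancy function `u_p(x) = C_κ ∫ (log p(x) − log p(x')) κ²(x,x') dx'`. -/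
def uDisc {α : Type*} [MeasureSpace α] [Zero α] (κ : α → α → ℝ) (p : α → ℝ) (x : α) : ℝ :=
  Cker κ * ∫ x', (Real.log (p x) - Real.log (p x')) * (κ x x') ^ 2

/-- Kernel-smoothed density `p̂(x) = C_κ ∫ p(x') κ²(x,x') dx'`. -/
def smoothed {α : Type*} [MeasureSpace α] [Zero α] (κ : α → α → ℝ) (p : α → ℝ) (x : α) : ℝ :=
  Cker κ * ∫ x', p x' * (κ x x') ^ 2

/-- Expected discrepancy `E'_p = |∫ p(x) u_p(x) dx|`. -/
def Edisc' {α : Type*} [MeasureSpace α] [Zero α] (κ : α → α → ℝ) (p : α → ℝ) : ℝ :=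
  |∫ x, p x * uDisc κ p x|

/-- Expected discrepancy `E_p = |∫ p̂(x) u_p(x) dx|` (at the smoothed density). -/
def Edisc {α : Type*} [MeasureSpace α] [Zero α] (κ : α → α → ℝ) (p : α → ℝ) : ℝ :=
  |∫ x, smoothed κ p x * uDisc κ p x|

/-- Kernelized Rényi divergence `D₁(p‖q) = C_κ ∬ p(x) log(p(x')/q(x')) κ²(x,x') dx dx'`. -/
def D1 {α : Type*} [MeasureSpace α] [Zero α] (κ : α → α → ℝ) (p q : α → ℝ) : ℝ :=
  Cker κ * ∫ x, ∫ x', p x * Real.log (p x' / q x') * (κ x x') ^ 2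

/-- Kernelized Rényi mutual information of a joint density `pXY` with marginals `pX`, `pY`. -/
def I1 {α β : Type*} [MeasureSpace α] [Zero α] [MeasureSpace β] [Zero β]
    (κX : α → α → ℝ) (κY : β → β → ℝ) (pXY : α × β → ℝ) (pX : α → ℝ) (pY : β → ℝ) : ℝ :=
  Cker κX * Cker κY * ∫ x, ∫ y, ∫ x', ∫ y',
    pXY (x, y) * Real.log (pXY (x', y') / (pX x' * pY y')) * (κX x x') ^ 2 * (κY y y') ^ 2

/-- Kernelized Rényi conditional mutual information `I₁(X;Y|Z)`, expressed through the joint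
density `pXYZ` of `(X,Y,Z)` and the marginal densities `pXZ`, `pYZ`, `pZ`
(so that e.g. `p_{XY|Z}(x,y|z) = pXYZ(x,y,z)/pZ(z)`). -/
def I1cond {α β γ : Type*} [MeasureSpace α] [Zero α] [MeasureSpace β] [Zero β]
    [MeasureSpace γ] [Zero γ]
    (κX : α → α → ℝ) (κY : β → β → ℝ) (κZ : γ → γ → ℝ) (pXYZ : α × β × γ → ℝ)
    (pXZ : α × γ → ℝ) (pYZ : β × γ → ℝ) (pZ : γ → ℝ) : ℝ :=
  Cker κX * Cker κY * Cker κZ * ∫ x, ∫ y, ∫ z, ∫ x', ∫ y', ∫ z',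
    pXYZ (x, y, z) *
      Real.log ((pXYZ (x', y', z') / pZ z') /
        ((pXZ (x', z') / pZ z') * (pYZ (y', z') / pZ z'))) *
      (κX x x') ^ 2 * (κY y y') ^ 2 * (κZ z z') ^ 2

/-- Density of the Gaussian distribution `N(0, Σ)` on `ℝ^d`:
`p(x) = (2π)^{−d/2} (det Σ)^{−1/2} exp(−xᵀ Σ⁻¹ x / 2)`. -/
def gaussDensity {d : ℕ} (Sig : Matrix (Fin d) (Fin d) ℝ) (x : Euc d) : ℝ :=
  (2 * π) ^ (-(d : ℝ) / 2) * Sig.det ^ (-(1 : ℝ) / 2) *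
    Real.exp (-(∑ i, ∑ j, x i * Sig⁻¹ i j * x j) / 2)

/-- The Gaussian kernel of width `σ_κ`: `κ(x,x') = exp(−‖x − x'‖²/(2σ_κ²))`. -/
def gaussKer {d : ℕ} (σκ : ℝ) : Euc d → Euc d → ℝ :=
  fun x x' => Real.exp (-‖x - x'‖ ^ 2 / (2 * σκ ^ 2))

lemma m_int (b : ℝ) (hb : 0 < b) (n : ℕ) : Integrable (fun t : ℝ => t ^ n * exp (-b * t ^ 2)) := by
  have := integrable_rpow_mul_exp_neg_mul_sq hb (s := (n : ℝ)) (by have := n.cast_nonneg (α := ℝ); linarith)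
  simpa using this

lemma m1 (b : ℝ) : ∫ t : ℝ, t ^ 1 * exp (-b * t ^ 2) = 0 := by
  have h := integral_neg_eq_self (fun t : ℝ => t ^ 1 * exp (-b * t ^ 2)) volume
  have h2 : ∫ t : ℝ, (-t) ^ 1 * exp (-b * (-t) ^ 2) = - ∫ t : ℝ, t ^ 1 * exp (-b * t ^ 2) := by
    rw [← integral_neg]; congr 1; ext t; simp
  linarith

lemma m2 (b : ℝ) (hb : 0 < b) : ∫ t : ℝ, t ^ 2 * exp (-b * t ^ 2) = √(π / b) / (2 * b) := by
  have hd : ∀ t : ℝ, HasDerivAt (fun t : ℝ => t ^ 1 * exp (-b * t ^ 2))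
      (exp (-b * t ^ 2) - 2 * b * (t ^ 2 * exp (-b * t ^ 2))) t := by
    intro t
    have := (hasDerivAt_pow 1 t).mul ((hasDerivAt_pow 2 t).const_mul (-b)).exp
    refine this.congr_deriv ?_
    simp; ring
  have i0 := m_int b hb 0
  simp only [pow_zero, one_mul] at i0
  have := integral_eq_zero_of_hasDerivAt_of_integrable hd (i0.sub ((m_int b hb 2).const_mul (2*b))) (m_int b hb 1)
  rw [integral_sub i0 ((m_int b hb 2).const_mul (2*b)), integral_const_mul, integral_gaussian] at this
  rw [eq_div_iff (by positivity)]; linarith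


lemma norm_sq_sum {d : ℕ} (x : Euc d) : ‖x‖ ^ 2 = ∑ i, x i ^ 2 := by
  rw [EuclideanSpace.norm_sq_eq]; simp

lemma mon_eq {d : ℕ} (b : ℝ) (n : Fin d → ℕ) (x : Euc d) :
    (∏ k, x k ^ n k) * exp (-b * ‖x‖ ^ 2) = ∏ k, (x k ^ n k * exp (-b * x k ^ 2)) := by
  rw [Finset.prod_mul_distrib, ← Real.exp_sum, norm_sq_sum, Finset.mul_sum]

lemma mon_int {d : ℕ} (b : ℝ) (hb : 0 < b) (n : Fin d → ℕ) :
    Integrable (fun x : Euc d => (∏ k, x k ^ n k) * exp (-b * ‖x‖ ^ 2)) := by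
  simp_rw [mon_eq]
  have h : Integrable (fun y : Fin d → ℝ => ∏ k, (y k ^ n k * exp (-b * y k ^ 2))) :=
    Integrable.fintype_prod (f := fun k (t : ℝ) => t ^ n k * exp (-b * t ^ 2))
      (fun k => m_int b hb (n k))
  exact ((EuclideanSpace.volume_preserving_symm_measurableEquiv_toLp (Fin d)).integrable_comp_emb
    (MeasurableEquiv.measurableEmbedding _)).2 h

lemma mon_integral {d : ℕ} (b : ℝ) (n : Fin d → ℕ) :
    ∫ x : Euc d, (∏ k, x k ^ n k) * exp (-b * ‖x‖ ^ 2)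
      = ∏ k, ∫ t : ℝ, t ^ n k * exp (-b * t ^ 2) := by
  simp_rw [mon_eq]
  rw [← integral_fintype_prod_volume_eq_prod (fun k (t : ℝ) => t ^ n k * exp (-b * t ^ 2))]
  exact (EuclideanSpace.volume_preserving_symm_measurableEquiv_toLp (Fin d)).integral_comp
    (MeasurableEquiv.measurableEmbedding _)
    (fun y : Fin d → ℝ => ∏ k, (y k ^ n k * exp (-b * y k ^ 2)))

lemma prod_single {d : ℕ} (x : Fin d → ℝ) (i : Fin d) :
    ∏ k, x k ^ (Pi.single i 1 : Fin d → ℕ) k = x i := by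
  rw [Finset.prod_eq_single i] <;> simp +contextual [Pi.single_apply]

lemma prod_single2 {d : ℕ} (x : Fin d → ℝ) (i j : Fin d) :
    ∏ k, x k ^ ((Pi.single i 1 : Fin d → ℕ) k + (Pi.single j 1 : Fin d → ℕ) k) = x i * x j := by
  simp_rw [pow_add]
  rw [Finset.prod_mul_distrib, prod_single, prod_single]

def ZZ (d : ℕ) (b : ℝ) : ℝ := √(π / b) ^ d

lemma I0i {d : ℕ} (b : ℝ) (hb : 0 < b) : Integrable (fun x : Euc d => exp (-b * ‖x‖ ^ 2)) := by
  simpa using mon_int (d := d) b hb 0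

lemma I0 {d : ℕ} (b : ℝ) : ∫ x : Euc d, exp (-b * ‖x‖ ^ 2) = ZZ d b := by
  have := mon_integral (d := d) b 0
  simpa [-neg_mul, integral_gaussian, ZZ] using this

lemma I1i {d : ℕ} (b : ℝ) (hb : 0 < b) (i : Fin d) :
    Integrable (fun x : Euc d => x i * exp (-b * ‖x‖ ^ 2)) := by
  have := mon_int (d := d) b hb (Pi.single i 1)
  simp_rw [prod_single] at this
  exact this

lemma I1z {d : ℕ} (b : ℝ) (i : Fin d) :
    ∫ x : Euc d, x i * exp (-b * ‖x‖ ^ 2) = 0 := by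
  have := mon_integral (d := d) b (Pi.single i 1)
  simp_rw [prod_single] at this
  rw [this]
  apply Finset.prod_eq_zero (Finset.mem_univ i)
  rw [Pi.single_eq_same]; exact m1 b

lemma I2i {d : ℕ} (b : ℝ) (hb : 0 < b) (i j : Fin d) :
    Integrable (fun x : Euc d => x i * x j * exp (-b * ‖x‖ ^ 2)) := by
  have := mon_int (d := d) b hb (fun k => (Pi.single i 1 : Fin d → ℕ) k + (Pi.single j 1 : Fin d → ℕ) k)
  simp_rw [prod_single2] at this
  exact this

lemma I2z {d : ℕ} (b : ℝ) (hb : 0 < b) (i j : Fin d) :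
    ∫ x : Euc d, x i * x j * exp (-b * ‖x‖ ^ 2) = if i = j then ZZ d b / (2 * b) else 0 := by
  have := mon_integral (d := d) b
    (fun k => (Pi.single i 1 : Fin d → ℕ) k + (Pi.single j 1 : Fin d → ℕ) k)
  simp_rw [prod_single2] at this
  rw [this]
  split_ifs with h
  · subst h
    have : ∀ k, ∫ t : ℝ, t ^ ((Pi.single i 1 : Fin d → ℕ) k + (Pi.single i 1 : Fin d → ℕ) k)
        * exp (-b * t ^ 2) = √(π / b) * (if k = i then 1 / (2 * b) else 1) := by
      intro k
      by_cases hk : k = i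
      · subst hk
        simp only [Pi.single_eq_same, if_true]
        rw [m2 b hb]; ring
      · simp only [Pi.single_eq_of_ne hk, if_neg hk]
        simpa [-neg_mul] using integral_gaussian b
    simp_rw [this]
    rw [Finset.prod_mul_distrib]
    simp [ZZ]
    ring
  · apply Finset.prod_eq_zero (Finset.mem_univ i)
    simp only [Pi.single_eq_same, Pi.single_eq_of_ne h]
    exact m1 b

def qf {d : ℕ} (P : Matrix (Fin d) (Fin d) ℝ) (x : Euc d) : ℝ := ∑ i, ∑ j, x i * P i j * x j

lemma qf_mul {d : ℕ} (P : Matrix (Fin d) (Fin d) ℝ) (x : Euc d) (r : ℝ) :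
    qf P x * r = ∑ i, ∑ j, P i j * (x i * x j * r) := by
  unfold qf
  simp_rw [Finset.sum_mul]
  refine Finset.sum_congr rfl fun i _ => Finset.sum_congr rfl fun j _ => by ring

lemma qf_i {d : ℕ} (P : Matrix (Fin d) (Fin d) ℝ) (b : ℝ) (hb : 0 < b) :
    Integrable (fun x : Euc d => qf P x * exp (-b * ‖x‖ ^ 2)) := by
  simp_rw [qf_mul]
  exact integrable_finsetSum _ fun i _ => integrable_finsetSum _ fun j _ =>
    (I2i b hb i j).const_mul _

lemma qf_z {d : ℕ} (P : Matrix (Fin d) (Fin d) ℝ) (b : ℝ) (hb : 0 < b) :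
    ∫ x : Euc d, qf P x * exp (-b * ‖x‖ ^ 2) = P.trace * (ZZ d b / (2 * b)) := by
  simp_rw [qf_mul]
  have h1 : ∀ i j, Integrable (fun x : Euc d => P i j * (x i * x j * exp (-b * ‖x‖ ^ 2))) :=
    fun i j => (I2i b hb i j).const_mul _
  have h2 : ∀ i, ∫ x : Euc d, ∑ j, P i j * (x i * x j * exp (-b * ‖x‖ ^ 2))
      = P i i * (ZZ d b / (2 * b)) := by
    intro i
    rw [integral_finsetSum _ fun j _ => h1 i j]
    simp_rw [integral_const_mul, I2z b hb]
    simp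
  have h3 : ∀ i, Integrable (fun x : Euc d => ∑ j, P i j * (x i * x j * exp (-b * ‖x‖ ^ 2))) :=
    fun i => integrable_finsetSum _ fun j _ => h1 i j
  refine (integral_finsetSum _ fun i _ => h3 i).trans ?_
  simp_rw [h2]
  simp [Matrix.trace, Finset.sum_mul]

lemma lin_i {d : ℕ} (c : Fin d → ℝ) (b : ℝ) (hb : 0 < b) :
    Integrable (fun x : Euc d => (∑ i, c i * x i) * exp (-b * ‖x‖ ^ 2)) := by
  simp_rw [Finset.sum_mul, mul_assoc]
  exact integrable_finsetSum _ fun i _ => (I1i b hb i).const_mul _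

lemma lin_z {d : ℕ} (c : Fin d → ℝ) (b : ℝ) (hb : 0 < b) :
    ∫ x : Euc d, (∑ i, c i * x i) * exp (-b * ‖x‖ ^ 2) = 0 := by
  simp_rw [Finset.sum_mul, mul_assoc]
  rw [integral_finsetSum _ fun i _ => (I1i b hb i).const_mul _]
  simp_rw [integral_const_mul, I1z]
  simp

lemma qf_add {d : ℕ} (P : Matrix (Fin d) (Fin d) ℝ) (x y : Euc d) :
    qf P (x + y) = qf P x + qf P y + ∑ i, (∑ j, (x j * P j i + P i j * x j)) * y i := by
  unfold qf
  simp_rw [Finset.sum_mul, add_mul, Finset.sum_add_distrib]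
  rw [Finset.sum_comm (f := fun i j => x j * P j i * y i)]
  simp_rw [← Finset.sum_add_distrib]
  refine Finset.sum_congr rfl fun i _ => Finset.sum_congr rfl fun j _ => ?_
  simp only [PiLp.add_apply]
  ring

lemma inner_int {d : ℕ} (P : Matrix (Fin d) (Fin d) ℝ) (b : ℝ) (hb : 0 < b) (c : ℝ) (x : Euc d) :
    ∫ x' : Euc d, (c - qf P x' / 2) * exp (-b * ‖x - x'‖ ^ 2) =
      ZZ d b * (c - qf P x / 2 - P.trace / (4 * b)) := by
  rw [← integral_add_left_eq_self _ x]
  have : ∀ y : Euc d, (c - qf P (x + y) / 2) * exp (-b * ‖x - (x + y)‖ ^ 2) =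
      (c - qf P x / 2) * exp (-b * ‖y‖ ^ 2) - (1 / 2) * (qf P y * exp (-b * ‖y‖ ^ 2))
      - (1 / 2) * ((∑ i, (∑ j, (x j * P j i + P i j * x j)) * y i) * exp (-b * ‖y‖ ^ 2)) := by
    intro y
    rw [qf_add, sub_add_cancel_left, norm_neg]; ring
  have hA : Integrable (fun y : Euc d => (c - qf P x / 2) * exp (-b * ‖y‖ ^ 2)
      - (1 / 2) * (qf P y * exp (-b * ‖y‖ ^ 2))) :=
    ((I0i b hb).const_mul _).sub ((qf_i P b hb).const_mul _)
  rw [integral_congr_ae (Filter.Eventually.of_forall this)]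
  rw [integral_sub hA ((lin_i _ b hb).const_mul _), integral_sub ((I0i b hb).const_mul _) ((qf_i P b hb).const_mul _),
    integral_const_mul, integral_const_mul, integral_const_mul, lin_z _ b hb, qf_z P b hb, I0]
  field_simp
  ring

lemma rad_int {d : ℕ} (b : ℝ) (hb : 0 < b) (α : ℝ) :
    ∫ x : Euc d, exp (-b * ‖x‖ ^ 2) * (α - ‖x‖ ^ 2 / 2) = ZZ d b * (α - d / (4 * b)) := by
  have h := inner_int (d := d) 1 b hb α 0
  have hq : ∀ x : Euc d, qf 1 x = ‖x‖ ^ 2 := by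
    intro x; rw [norm_sq_sum]; simp [qf, Matrix.one_apply, pow_two]
  simp_rw [hq] at h
  simp only [zero_sub, norm_neg, Matrix.trace_one, Fintype.card_fin] at h
  simp_rw [mul_comm (exp _)]
  rw [h]; simp

lemma cov_int {d : ℕ} (B : Matrix (Fin d) (Fin d) ℝ) (hB : B.det ≠ 0) (F : Euc d → ℝ) :
    ∫ x : Euc d, F (Matrix.toEuclideanLin B x) = |B.det|⁻¹ * ∫ x, F x := by
  have hdet : LinearMap.det (Matrix.toEuclideanLin B) = B.det := by
    exact LinearMap.det_toLpLin 2 B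
  have hm := Measure.map_linearMap_addHaar_eq_smul_addHaar (volume : Measure (Euc d))
    (f := Matrix.toEuclideanLin B) (by rw [hdet]; exact hB)
  have hemb : MeasurableEmbedding (Matrix.toEuclideanLin B : Euc d → Euc d) := by
    let e := (LinearMap.equivOfDetNeZero (Matrix.toEuclideanLin B) (by rw [hdet]; exact hB)).toContinuousLinearEquiv
    exact e.toHomeomorph.measurableEmbedding
  rw [← hemb.integral_map, hm, integral_smul_measure, hdet, ENNReal.toReal_ofReal (abs_nonneg _),
    abs_inv, smul_eq_mul]

open scoped MatrixOrder in
lemma exists_sqrt {d : ℕ} (P : Matrix (Fin d) (Fin d) ℝ) (hP : P.PosDef) :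
    ∃ B : Matrix (Fin d) (Fin d) ℝ, B * B = P ∧ B.transpose = B := by
  refine ⟨CFC.sqrt P, CFC.sqrt_mul_sqrt_self _ hP.posSemidef.nonneg, ?_⟩
  have h : star (CFC.sqrt P) = CFC.sqrt P := (CFC.sqrt_nonneg P).isSelfAdjoint
  rwa [Matrix.star_eq_conjTranspose, Matrix.conjTranspose_eq_transpose_of_trivial] at h

lemma qf_eq {d : ℕ} (P B : Matrix (Fin d) (Fin d) ℝ) (h : B * B = P) (ht : B.transpose = B)
    (x : Euc d) : qf P x = ‖Matrix.toEuclideanLin B x‖ ^ 2 := by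
  have e : qf P x = x.ofLp ⬝ᵥ P.mulVec x.ofLp := by
    simp [qf, dotProduct, Matrix.mulVec, Finset.mul_sum, mul_assoc]
  rw [e, norm_sq_sum, ← h, ← Matrix.mulVec_mulVec, Matrix.dotProduct_mulVec,
    ← Matrix.mulVec_transpose, ht]
  simp [dotProduct, pow_two, Matrix.toLpLin_apply]

/-- for a symmetric positive definite `Σ`, the kernelized Rényi entropy of the
`N(0, Σ)` density computed with the Gaussian kernel of width `σ_κ > 0` equals
`(d/2) log(2πe) + (1/2) log det Σ + (σ_κ²/4) tr(Σ⁻¹)`. -/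
theorem statement9 {d : ℕ} (Sig : Matrix (Fin d) (Fin d) ℝ)
    (hSigSym : Sig.IsSymm) (hSigPd : Sig.PosDef)
    (σκ : ℝ) (hσκ : 0 < σκ) :
    S1 (gaussKer (d := d) σκ) (gaussDensity Sig) =
      ((d : ℝ) / 2) * Real.log (2 * π * Real.exp 1) +
        (1 / 2) * Real.log Sig.det + σκ ^ 2 / 4 * (Sig⁻¹).trace := by
  have hdet : 0 < Sig.det := hSigPd.det_pos
  have hP : (Sig⁻¹).PosDef := hSigPd.inv
  obtain ⟨B, hBB, hBt⟩ := exists_sqrt _ hP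
  have hBd : B.det * B.det = (Sig.det)⁻¹ := by
    rw [← Matrix.det_mul, hBB, Matrix.det_nonsing_inv, Ring.inverse_eq_inv']
  have hB0 : B.det ≠ 0 := by
    intro h; rw [h] at hBd; have := inv_pos.2 hdet; simp at hBd; linarith
  set b : ℝ := 1 / σκ ^ 2 with hb
  have hbp : 0 < b := by positivity
  have hker : ∀ x x' : Euc d, gaussKer σκ x x' ^ 2 = exp (-b * ‖x - x'‖ ^ 2) := by
    intro x x'
    rw [gaussKer, ← Real.exp_nat_mul]; congr 1; rw [hb]; push_cast; field_simp
  have hZ : ZZ d b ≠ 0 := by unfold ZZ; positivity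
  have hC : Cker (gaussKer (d := d) σκ) = 1 / ZZ d b := by
    unfold Cker
    simp_rw [hker, zero_sub, norm_neg]
    rw [I0]
  set K : ℝ := (2 * π) ^ (-(d : ℝ) / 2) * Sig.det ^ (-(1 : ℝ) / 2) with hK
  have hKp : 0 < K := by positivity
  have hp : ∀ x, gaussDensity Sig x = K * exp (-(1 / 2) * qf Sig⁻¹ x) := by
    intro x; unfold gaussDensity qf; rw [hK]; congr 2; ring
  have hlog : ∀ x, Real.log (gaussDensity Sig x) = Real.log K - qf Sig⁻¹ x / 2 := by
    intro x
    rw [hp, Real.log_mul hKp.ne' (exp_pos _).ne', Real.log_exp]; ring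
  have hin : ∀ x : Euc d, ∫ x', gaussDensity Sig x * Real.log (gaussDensity Sig x')
      * (gaussKer σκ x x') ^ 2 = K * ZZ d b * (exp (-(1 / 2) * ‖Matrix.toEuclideanLin B x‖ ^ 2) *
        ((Real.log K - (Sig⁻¹).trace / (4 * b)) - ‖Matrix.toEuclideanLin B x‖ ^ 2 / 2)) := by
    intro x
    simp_rw [hker, hlog, mul_assoc]
    rw [integral_const_mul, inner_int _ b hbp, hp, qf_eq _ B hBB hBt]
    ring
  have hout : ∫ x : Euc d, ∫ x', gaussDensity Sig x * Real.log (gaussDensity Sig x')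
      * (gaussKer σκ x x') ^ 2 = K * ZZ d b * (|B.det|⁻¹ *
        (ZZ d (1 / 2) * (Real.log K - (Sig⁻¹).trace / (4 * b) - d / (4 * (1 / 2))))) := by
    simp_rw [hin]
    rw [integral_const_mul, cov_int B hB0 (fun y => exp (-(1 / 2) * ‖y‖ ^ 2) *
        ((Real.log K - (Sig⁻¹).trace / (4 * b)) - ‖y‖ ^ 2 / 2)), rad_int _ (by norm_num)]
  have hnorm : K * |B.det|⁻¹ * ZZ d (1 / 2) = 1 := by
    have h1 : |B.det| = Sig.det ^ (-(1 : ℝ) / 2) := by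
      rw [← Real.sqrt_mul_self_eq_abs, hBd, Real.sqrt_eq_rpow, Real.inv_rpow hdet.le,
        ← Real.rpow_neg hdet.le]
      norm_num
    have h2 : ZZ d (1 / 2) = ((2 * π) ^ (-(d : ℝ) / 2))⁻¹ := by
      unfold ZZ
      rw [← Real.rpow_neg (by positivity), Real.sqrt_eq_rpow, ← Real.rpow_natCast,
        ← Real.rpow_mul (by positivity)]
      congr 1 <;> ring
    rw [h1, h2, hK]
    have := (Real.rpow_pos_of_pos hdet (-(1 : ℝ) / 2)).ne'
    have := (Real.rpow_pos_of_pos (show 0 < 2 * π by positivity) (-(d : ℝ) / 2)).ne'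
    field_simp
  have hlogK : Real.log K = -(d : ℝ) / 2 * Real.log (2 * π) - 1 / 2 * Real.log Sig.det := by
    rw [hK, Real.log_mul (by positivity) (by positivity), Real.log_rpow (by positivity),
      Real.log_rpow hdet]
    ring
  unfold S1
  rw [hC, hout, Real.log_mul (by positivity) (exp_pos _).ne', Real.log_exp]
  have hfin : 1 / ZZ d b * (K * ZZ d b * (|B.det|⁻¹ *
        (ZZ d (1 / 2) * (Real.log K - (Sig⁻¹).trace / (4 * b) - d / (4 * (1 / 2)))))) =
      (K * |B.det|⁻¹ * ZZ d (1 / 2)) *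
        (Real.log K - (Sig⁻¹).trace / (4 * b) - d / (4 * (1 / 2))) := by
    field_simp
  rw [hfin, hnorm, hlogK, hb]
  field_simp
  ring
end
end

section
/- Fix η_t, σ_t > 0 and d ≥ 1, and let 𝕍_t be a d×d symmetric positive semidefinite real matrix with V_t = tr(𝕍_t). Let {c_i}_{i=1}^r be a partition of the index set {1,…,d} into disjoint nonempty blocks, and let 𝕍_t^i be the principal submatrix of 𝕍_t with rows and columns indexed by c_i. Define θ_c(𝕍) = (1/2) log det( (η_t²/σ_t²) 𝕍 + I ) and θ_v(V) = (d/2) log( η_t² V / (d σ_t²) + 1 ). Then, for any L ≥ V_t, the chain of inequalities θ_c(𝕍_t) ≤ Σ_{i=1}^r θ_c(𝕍_t^i) ≤ θ_v(V_t) ≤ θ_v(L) holds. -/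
open Matrix

noncomputable section

variable (ηt σt : ℝ)

/-- `θ_c(𝕍) = (1/2) log det((η_t²/σ_t²) 𝕍 + I)`, defined for a square matrix over any
finite index type (so it can be applied both to `𝕍_t` and to its principal submatrices). -/
def θc {ι : Type*} [Fintype ι] [DecidableEq ι] (V : Matrix ι ι ℝ) : ℝ :=
  (1 / 2) * Real.log ((ηt ^ 2 / σt ^ 2) • V + 1).det

/-- `θ_v(V) = (d/2) log(η_t² V / (d σ_t²) + 1)`. -/
def θv (d : ℕ) (V : ℝ) : ℝ :=
  ((d : ℝ) / 2) * Real.log (ηt ^ 2 * V / (d * σt ^ 2) + 1)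

theorem aux_log_det_le {n : Type*} [Fintype n] [DecidableEq n] {A : Matrix n n ℝ}
    (hA : A.PosDef) : Real.log A.det ≤ A.trace - Fintype.card n := by
  rw [hA.isHermitian.det_eq_prod_eigenvalues, hA.isHermitian.trace_eq_sum_eigenvalues]
  simp only [RCLike.ofReal_real_eq_id, id]
  rw [Real.log_prod (fun i _ => (hA.eigenvalues_pos i).ne')]
  have : (Fintype.card n : ℝ) = ∑ i : n, (1:ℝ) := by simp
  rw [this, ← Finset.sum_sub_distrib]
  exact Finset.sum_le_sum fun i _ => Real.log_le_sub_one_of_pos (hA.eigenvalues_pos i)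

theorem aux_log_det_le_scale {n : Type*} [Fintype n] [DecidableEq n] {A : Matrix n n ℝ}
    (hA : A.PosDef) {s : ℝ} (hs : 0 < s) :
    Real.log A.det ≤ Fintype.card n * Real.log s + s⁻¹ * A.trace - Fintype.card n := by
  have h := aux_log_det_le (hA.smul (inv_pos.mpr hs))
  rw [det_smul, trace_smul, Real.log_mul (by positivity) hA.det_pos.ne', Real.log_pow,
    Real.log_inv, smul_eq_mul] at h
  linarith

open scoped MatrixOrder in
theorem aux_exists_factor {n : Type*} [Fintype n] [DecidableEq n] {A : Matrix n n ℝ}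
    (hA : A.PosDef) : ∃ C : Matrix n n ℝ, C * A * Cᴴ = 1 := by
  obtain ⟨S, hS, h⟩ := CStarAlgebra.isStrictlyPositive_iff_eq_star_mul_self.mp
    hA.isStrictlyPositive
  have hd : IsUnit S.det := (isUnit_iff_isUnit_det S).mp hS
  have hd2 : IsUnit Sᴴ.det := by rw [det_conjTranspose]; exact hd.star
  refine ⟨Sᴴ⁻¹, ?_⟩
  rw [h, star_eq_conjTranspose, ← mul_assoc, nonsing_inv_mul _ hd2, one_mul,
    conjTranspose_nonsing_inv, conjTranspose_conjTranspose, mul_nonsing_inv _ hd]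

theorem aux_det_blockDiagonal {r : ℕ} {n : Fin r → Type*} [∀ i, Fintype (n i)]
    [∀ i, DecidableEq (n i)] (D : ∀ i, Matrix (n i) (n i) ℝ) :
    (blockDiagonal' D).det = ∏ i, (D i).det := by
  have hb : BlockTriangular (blockDiagonal' D) Sigma.fst := blockTriangular_blockDiagonal' D
  rw [hb.det_fintype]
  refine Finset.prod_congr rfl fun i _ => ?_
  rw [← det_submatrix_equiv_self (Equiv.sigmaSubtype i).symm]
  congr 1
  ext a b
  simp [toSquareBlock_def, Equiv.sigmaSubtype, blockDiagonal'_apply]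

theorem aux_trace {r : ℕ} {n : Fin r → Type*} [∀ i, Fintype (n i)]
    [∀ i, DecidableEq (n i)] (D : ∀ i, Matrix (n i) (n i) ℝ)
    (A : Matrix (Σ i, n i) (Σ i, n i) ℝ) :
    (blockDiagonal' D * A).trace = ∑ i, (D i * blockDiag' A i).trace := by
  simp only [trace, diag_apply, mul_apply, Fintype.sum_sigma, blockDiag'_apply]
  refine Finset.sum_congr rfl fun i _ => Finset.sum_congr rfl fun a _ => ?_
  rw [Finset.sum_eq_single i]
  · simp
  · intro j _ hj
    exact Finset.sum_eq_zero fun b _ => by rw [blockDiagonal'_apply_ne _ _ _ hj.symm, zero_mul]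
  · simp

theorem aux_fischer {r : ℕ} {n : Fin r → Type*} [∀ i, Fintype (n i)]
    [∀ i, DecidableEq (n i)] {A : Matrix (Σ i, n i) (Σ i, n i) ℝ} (hA : A.PosDef) :
    Real.log A.det ≤ ∑ i, Real.log (blockDiag' A i).det := by
  have hAi : ∀ i, (blockDiag' A i).PosDef := fun i =>
    hA.submatrix (e := fun a : n i => (⟨i, a⟩ : Σ i, n i)) sigma_mk_injective
  choose C hC using fun i => aux_exists_factor (hAi i)
  have hdet : ∀ i, (C i).det * (C i).det * (blockDiag' A i).det = 1 := fun i => by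
    have := congrArg det (hC i)
    rw [det_mul, det_mul, det_conjTranspose, det_one, star_trivial] at this
    linarith
  have hC0 : ∀ i, (C i).det ≠ 0 := fun i h => by
    have := hdet i
    rw [h] at this; simp at this
  have hlog : ∀ i, Real.log ((C i).det) + Real.log ((C i).det)
      + Real.log (blockDiag' A i).det = 0 := fun i => by
    rw [← Real.log_mul (hC0 i) (hC0 i), ← Real.log_mul (mul_ne_zero (hC0 i) (hC0 i))
      (hAi i).det_pos.ne', hdet i, Real.log_one]
  set B := blockDiagonal' C with hB
  have hBd : B.det = ∏ i, (C i).det := aux_det_blockDiagonal C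
  have hB0 : B.det ≠ 0 := by rw [hBd]; exact Finset.prod_ne_zero_iff.mpr fun i _ => hC0 i
  have hBu : IsUnit B := (isUnit_iff_isUnit_det B).mpr hB0.isUnit
  have hM : (B * A * Bᴴ).PosDef := (IsUnit.posDef_star_right_conjugate_iff hBu).mpr hA
  have h := aux_log_det_le hM
  have htr : (B * A * Bᴴ).trace = Fintype.card (Σ i, n i) := by
    rw [trace_mul_comm, ← mul_assoc, hB, blockDiagonal'_conjTranspose, ← blockDiagonal'_mul,
      aux_trace, Fintype.card_sigma]
    push_cast
    refine Finset.sum_congr rfl fun i _ => ?_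
    rw [mul_assoc, trace_mul_comm, hC i, trace_one]
  rw [htr, det_mul, det_mul, det_conjTranspose, star_trivial,
    Real.log_mul (mul_ne_zero hB0 hA.det_pos.ne') hB0, Real.log_mul hB0 hA.det_pos.ne', hBd,
    Real.log_prod (fun i _ => hC0 i)] at h
  have hs : ∑ i, (Real.log ((C i).det) + Real.log ((C i).det)
      + Real.log (blockDiag' A i).det) = 0 := Finset.sum_eq_zero fun i _ => hlog i
  rw [Finset.sum_add_distrib, Finset.sum_add_distrib] at hs
  linarith

/-- for `η_t, σ_t > 0`, `d ≥ 1`, a symmetric positive semidefinite `d×d` matrix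
`𝕍_t` with `V_t = tr(𝕍_t)`, a partition `{c_i}_{i=1}^r` of `{1,…,d}` into disjoint nonempty
blocks with principal submatrices `𝕍_t^i`, and any `L ≥ V_t`, one has
`θ_c(𝕍_t) ≤ Σ_i θ_c(𝕍_t^i) ≤ θ_v(V_t) ≤ θ_v(L)`. -/
theorem statement13 {d r : ℕ} (hd : 1 ≤ d)
    (hη : 0 < ηt) (hσ : 0 < σt)
    (V : Matrix (Fin d) (Fin d) ℝ) (hsymm : V.IsSymm) (hpsd : V.PosSemidef)
    (c : Fin r → Finset (Fin d))
    (hdisj : ∀ i j : Fin r, i ≠ j → Disjoint (c i) (c j))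
    (hcover : Finset.univ.biUnion c = (Finset.univ : Finset (Fin d)))
    (hne : ∀ i, (c i).Nonempty)
    (L : ℝ) (hL : V.trace ≤ L) :
    θc ηt σt V ≤ ∑ i : Fin r, θc ηt σt (V.submatrix (Subtype.val : c i → Fin d) Subtype.val) ∧
      (∑ i : Fin r, θc ηt σt (V.submatrix (Subtype.val : c i → Fin d) Subtype.val)) ≤
        θv ηt σt d V.trace ∧
      θv ηt σt d V.trace ≤ θv ηt σt d L := by
  set k := ηt ^ 2 / σt ^ 2 with hk
  have hk0 : 0 < k := by positivity
  have hd0 : (0:ℝ) < d := by exact_mod_cast hd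
  have htr0 : 0 ≤ V.trace := hpsd.trace_nonneg
  have hform : ∀ x : ℝ, ηt ^ 2 * x / (d * σt ^ 2) + 1 = k * x / d + 1 := fun x => by
    rw [hk]; field_simp
  have hA : (k • V + 1).PosDef := PosDef.posSemidef_add (hpsd.smul hk0.le) PosDef.one
  have hsub : ∀ i, k • V.submatrix (Subtype.val : c i → Fin d) (Subtype.val : c i → Fin d) + 1
      = (k • V + 1).submatrix (Subtype.val : c i → Fin d) (Subtype.val : c i → Fin d) := fun i => by
    ext a b
    simp only [Matrix.add_apply, Matrix.smul_apply, submatrix_apply, one_apply, Subtype.val_inj]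
  have hAi : ∀ i, ((k • V + 1).submatrix (Subtype.val : c i → Fin d) (Subtype.val : c i → Fin d)).PosDef :=
    fun i => hA.submatrix Subtype.val_injective
  let g : (Σ i, c i) → Fin d := fun p => p.2.1
  have hg : Function.Bijective g := by
    constructor
    · rintro ⟨i, a, ha⟩ ⟨j, b, hb⟩ hab
      have hab' : a = b := hab
      subst hab'
      by_cases hij : i = j
      · subst hij; rfl
      · exact absurd hb (Finset.disjoint_left.mp (hdisj i j hij) ha)
    · intro x
      have hx : x ∈ Finset.univ.biUnion c := by rw [hcover]; exact Finset.mem_univ x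
      obtain ⟨i, _, hi⟩ := Finset.mem_biUnion.mp hx
      exact ⟨⟨i, x, hi⟩, rfl⟩
  let e : (Σ i, c i) ≃ Fin d := Equiv.ofBijective g hg
  refine ⟨?_, ?_, ?_⟩
  · simp only [θc, ← hk, hsub]
    rw [← Finset.mul_sum]
    have h := aux_fischer (hA.submatrix e.injective)
    rw [det_submatrix_equiv_self] at h
    exact mul_le_mul_of_nonneg_left h (by norm_num)
  · simp only [θc, θv, ← hk, hsub, hform]
    rw [← Finset.mul_sum]
    set s := k * V.trace / d + 1 with hs
    have hs0 : 0 < s := by positivity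
    have h := Finset.sum_le_sum fun (i : Fin r) (_ : i ∈ Finset.univ) =>
      aux_log_det_le_scale (hAi i) hs0
    rw [Finset.sum_sub_distrib, Finset.sum_add_distrib, ← Finset.sum_mul, ← Finset.mul_sum] at h
    have hcard : ∑ i, (Fintype.card (c i) : ℝ) = d := by
      have := Fintype.card_congr e
      rw [Fintype.card_sigma, Fintype.card_fin] at this
      exact_mod_cast this
    have htr : ∑ i, ((k • V + 1).submatrix (Subtype.val : c i → Fin d) (Subtype.val : c i → Fin d)).trace
        = s * d := by
      have h1 : ∑ i, ((k • V + 1).submatrix (Subtype.val : c i → Fin d) (Subtype.val : c i → Fin d)).trace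
          = (k • V + 1).trace := by
        simp only [trace]
        rw [← e.sum_comp, Fintype.sum_sigma]
        rfl
      rw [h1, trace_add, trace_smul, trace_one, Fintype.card_fin, hs, smul_eq_mul]
      field_simp
    rw [hcard, htr, inv_mul_cancel_left₀ hs0.ne'] at h
    linarith
  · simp only [θv, hform]
    gcongr
end
end

section
/- For all a, b ∈ [0,1], writing δ = |a − b| and adopting the convention 0 · log 0 = 0, one has |a log a − b log b| ≤ max( −δ log δ , −(1 − δ) log(1 − δ) ). -/
theorem aux_conv (a c d : ℝ) (ha : 0 ≤ a) (hac : a ≤ c) (hd : 0 < d) :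
    (a + d) * Real.log (a + d) + c * Real.log c ≤
      a * Real.log a + (c + d) * Real.log (c + d) := by
  have hL : 0 < c + d - a := by linarith
  have hcv := Real.convexOn_mul_log.2
  have ha' : a ∈ Set.Ici (0 : ℝ) := ha
  have hc' : c + d ∈ Set.Ici (0 : ℝ) := by
    show 0 ≤ c + d
    linarith
  have ht : 0 ≤ d / (c + d - a) := by positivity
  have hs : 0 ≤ (c - a) / (c + d - a) := div_nonneg (by linarith) hL.le
  have hst : (c - a) / (c + d - a) + d / (c + d - a) = 1 := by
    rw [← add_div, div_eq_one_iff_eq hL.ne']; ring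
  have h1 := hcv ha' hc' hs ht hst
  have h2 := hcv ha' hc' ht hs (by rw [add_comm]; exact hst)
  simp only [smul_eq_mul] at h1 h2
  have e1 : (c - a) / (c + d - a) * a + d / (c + d - a) * (c + d) = a + d := by
    field_simp; ring
  have e2 : d / (c + d - a) * a + (c - a) / (c + d - a) * (c + d) = c := by
    field_simp; ring
  rw [e1] at h1
  rw [e2] at h2
  have hs' : (c - a) / (c + d - a) = 1 - d / (c + d - a) := by linarith
  rw [hs'] at h1 h2
  linarith

theorem aux_main (a b : ℝ) (ha : 0 ≤ a) (hb : b ≤ 1) (hab : a < b) :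
    |a * Real.log a - b * Real.log b| ≤
      max (-((b - a) * Real.log (b - a))) (-((1 - (b - a)) * Real.log (1 - (b - a)))) := by
  have h1 := aux_conv 0 a (b - a) le_rfl ha (by linarith)
  have h2 := aux_conv a (1 - (b - a)) (b - a) ha (by linarith) (by linarith)
  simp only [zero_add, zero_mul, add_sub_cancel, sub_add_cancel, Real.log_one, mul_zero,
    add_zero] at h1 h2
  rw [abs_le]
  constructor
  · have := le_max_right (-((b - a) * Real.log (b - a)))
      (-((1 - (b - a)) * Real.log (1 - (b - a))))
    linarith
  · have := le_max_left (-((b - a) * Real.log (b - a)))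
      (-((1 - (b - a)) * Real.log (1 - (b - a))))
    linarith

/-- for `a, b ∈ [0,1]`, writing `δ = |a − b|` and with the convention
`0 · log 0 = 0` (which holds definitionally for `Real.log`), one has
`|a log a − b log b| ≤ max(−δ log δ, −(1 − δ) log(1 − δ))`. -/
theorem statement17 (a b : ℝ) (ha : a ∈ Set.Icc (0 : ℝ) 1) (hb : b ∈ Set.Icc (0 : ℝ) 1) :
    |a * Real.log a - b * Real.log b| ≤
      max (-(|a - b| * Real.log |a - b|)) (-((1 - |a - b|) * Real.log (1 - |a - b|))) := by
  rcases lt_trichotomy a b with h | h | h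
  · rw [abs_sub_comm a b, abs_of_pos (sub_pos.2 h)]
    exact aux_main a b ha.1 hb.2 h
  · subst h
    simp
  · rw [abs_of_pos (sub_pos.2 h), abs_sub_comm]
    exact aux_main b a hb.1 ha.2 h
end
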